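/- Let (W,S) be a Coxeter system of rank 3 with S = {r,s,t}, in which rt = tr (the product rt has order 2), the order of st equals 3, and the order m_{sr} of sr satisfies m_{sr} ≥ 7 (possibly infinite). Then there is no element w of W admitting elements w₁, w₂ ∈ W with w = w₁·s·t, ℓ(w) = ℓ(w₁) + 2, and w = w₂·s·r, ℓ(w) = ℓ(w₂) + 2. -/

import Mathlib

open LaurentPolynomial

namespace CoxeterSystem

variable {B W : Type*} [Group W] {M : CoxeterMatrix B} (cs : CoxeterSystem M W)

open scoped Classical in
/-- The permutation of `W × ZMod 2` by which the simple reflection `i` acts: it conjugates the first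
component and flips the second exactly at the simple reflection itself. -/
noncomputable def signedConj (i : B) : Equiv.Perm (W × ZMod 2) :=
  Function.Involutive.toPerm
    (fun p ↦ (cs.simple i * p.1 * cs.simple i, p.2 + if p.1 = cs.simple i then 1 else 0)) <| by
    rintro ⟨x, e⟩
    have h : cs.simple i * x * cs.simple i = cs.simple i ↔ x = cs.simple i := by
      constructor
      · intro h
        have := congrArg (fun y ↦ cs.simple i * y * cs.simple i) h
        simpa [mul_assoc] using this
      · rintro rfl
        simp
    ext
    · simp [mul_assoc]
    · simp only [h]
      split_ifs
      · rw [add_assoc, CharTwo.add_self_eq_zero, add_zero]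
      · simp

open scoped Classical in
theorem signedConj_apply (i : B) (x : W) (e : ZMod 2) :
    cs.signedConj i (x, e) =
      (cs.simple i * x * cs.simple i, e + if x = cs.simple i then 1 else 0) := rfl

open scoped Classical in
theorem signedConj_mul_pow_apply (i j : B) (n : ℕ) (x : W) (e : ZMod 2) :
    ((cs.signedConj i * cs.signedConj j) ^ n) (x, e) =
      ((cs.simple i * cs.simple j) ^ n * x * ((cs.simple i * cs.simple j) ^ n)⁻¹,
        e + ∑ k ∈ Finset.range (2 * n),
          if x = cs.simple j * (cs.simple i * cs.simple j) ^ k then 1 else 0) := by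
  induction n with
  | zero => simp
  | succ n ih =>
    set c := cs.simple i * cs.simple j with hc
    have hj : cs.simple j * c * cs.simple j = c⁻¹ := by simp [hc, mul_assoc]
    have hjk (k : ℕ) : c ^ k * cs.simple j * c ^ k = cs.simple j := by
      have h1 : cs.simple j * c ^ k * cs.simple j = (c ^ k)⁻¹ := by
        rw [← inv_pow, ← hj]
        have := conj_pow (i := k) (a := cs.simple j) (b := c)
        rw [cs.inv_simple] at this
        exact this.symm
      have h2 : c ^ k * (cs.simple j * c ^ k * cs.simple j) * cs.simple j = cs.simple j := by
        rw [h1]; simp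
      simpa [mul_assoc] using h2
    have e1 : c ^ n * x * (c ^ n)⁻¹ = cs.simple j ↔ x = cs.simple j * c ^ (2 * n) := by
      rw [mul_inv_eq_iff_eq_mul]
      nth_rewrite 1 [← hjk n]
      rw [two_mul, pow_add, ← mul_left_cancel_iff (a := c ^ n) (b := x)]
      simp only [mul_assoc]
    have e2 : cs.simple j * (c ^ n * x * (c ^ n)⁻¹) * cs.simple j = cs.simple i ↔
        x = cs.simple j * c ^ (2 * n + 1) := by
      have hi : cs.simple i = c * cs.simple j := by simp [hc]
      rw [show cs.simple i = cs.simple j * (cs.simple j * c) * cs.simple j by simp [hi],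
        mul_left_inj, mul_right_inj, mul_inv_eq_iff_eq_mul]
      nth_rewrite 1 [← hjk n]
      rw [show 2 * n + 1 = n + 1 + n by ring, pow_add, pow_succ,
        ← mul_left_cancel_iff (a := c ^ n) (b := x)]
      simp only [mul_assoc]
    rw [pow_succ', Equiv.Perm.mul_apply, ih, Equiv.Perm.mul_apply, signedConj_apply,
      signedConj_apply, e1, e2, show 2 * (n + 1) = 2 * n + 1 + 1 by ring, Finset.sum_range_succ,
      Finset.sum_range_succ]
    ext
    · have hinv : c⁻¹ = cs.simple j * cs.simple i := by simp [hc]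
      simp only [pow_succ' c n, mul_inv_rev, hinv]
      simp only [hc, mul_assoc]
    · simp only [add_assoc]

theorem isLiftable_signedConj : M.IsLiftable cs.signedConj := by
  classical
  intro i j
  ext1 ⟨x, e⟩
  have hc := cs.simple_mul_simple_pow i j
  rw [signedConj_mul_pow_apply, hc, two_mul, Finset.sum_range_add]
  simp [pow_add, hc, CharTwo.add_self_eq_zero]

open scoped Classical in
theorem lift_signedConj_wordProd_apply (ω : List B) (x : W) (e : ZMod 2) :
    cs.lift ⟨cs.signedConj, cs.isLiftable_signedConj⟩ (cs.wordProd ω) (x, e) =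
      (cs.wordProd ω * x * (cs.wordProd ω)⁻¹, e + ((cs.rightInvSeq ω).count x : ZMod 2)) := by
  induction ω with
  | nil => simp
  | cons i ω ih =>
    rw [wordProd_cons, map_mul, Equiv.Perm.mul_apply, ih, lift_apply_simple, signedConj_apply]
    have h : cs.wordProd ω * x * (cs.wordProd ω)⁻¹ = cs.simple i ↔
        (cs.wordProd ω)⁻¹ * cs.simple i * cs.wordProd ω = x := by
      rw [mul_inv_eq_iff_eq_mul, mul_assoc, inv_mul_eq_iff_eq_mul, eq_comm]
    ext
    · simp [mul_assoc]
    · simp only [rightInvSeq, List.count_cons, h, beq_iff_eq]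
      push_cast
      rw [add_assoc]

open scoped Classical in
/-- The parity of the multiplicity of an element in the right inversion sequence of a word depends
only on the product of the word. -/
theorem count_rightInvSeq_eq_of_wordProd_eq {ω ω' : List B} (h : cs.wordProd ω = cs.wordProd ω')
    (x : W) : ((cs.rightInvSeq ω).count x : ZMod 2) = (cs.rightInvSeq ω').count x := by
  have h1 := cs.lift_signedConj_wordProd_apply ω x 0
  rw [h, lift_signedConj_wordProd_apply] at h1
  simpa using (congrArg Prod.snd h1).symm

/-- The exchange property. -/
theorem simple_mem_rightInvSeq {ω : List B} {i : B}
    (hi : cs.IsRightDescent (cs.wordProd ω) i) : cs.simple i ∈ cs.rightInvSeq ω := by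
  classical
  obtain ⟨ω', hω', h⟩ := cs.exists_isReduced (cs.wordProd ω * cs.simple i)
  have hprod : cs.wordProd ω = cs.wordProd (ω'.concat i) := by
    rw [wordProd_concat, ← h]; simp
  have hnot : cs.simple i ∉ cs.rightInvSeq ω' := by
    intro hmem
    have := (cs.isRightInversion_of_mem_rightInvSeq hω' hmem).2
    rw [← h] at this
    simp only [simple_mul_simple_cancel_right] at this
    exact absurd hi (not_lt.2 this.le)
  have hcount := cs.count_rightInvSeq_eq_of_wordProd_eq hprod (cs.simple i)
  have hconj : MulAut.conj (cs.simple i) (cs.simple i) = cs.simple i := by simp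
  have h0 : ((cs.rightInvSeq ω').map (MulAut.conj (cs.simple i))).count (cs.simple i) = 0 := by
    refine List.count_eq_zero.2 fun hmem ↦ ?_
    obtain ⟨y, hy, hyi⟩ := List.mem_map.1 hmem
    exact hnot ((MulAut.conj (cs.simple i)).injective (hyi.trans hconj.symm) ▸ hy)
  rw [rightInvSeq_concat, List.concat_eq_append, List.count_append, h0] at hcount
  by_contra hmem
  rw [List.count_eq_zero.2 hmem] at hcount
  simp at hcount

theorem rightInvSeq_append (ω ω' : List B) :
    cs.rightInvSeq (ω ++ ω') =
      (cs.rightInvSeq ω).map (fun x ↦ (cs.wordProd ω')⁻¹ * x * cs.wordProd ω') ++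
        cs.rightInvSeq ω' := by
  induction ω with
  | nil => simp
  | cons i ω ih => simp [rightInvSeq, ih, wordProd_append, mul_assoc]

theorem exists_of_mem_rightInvSeq_alternatingWord {i j : B} {k : ℕ} {x : W}
    (hx : x ∈ cs.rightInvSeq (alternatingWord i j k)) :
    ∃ q < k, x = cs.simple j * (cs.simple i * cs.simple j) ^ q := by
  induction k generalizing i j x with
  | zero => simp [alternatingWord] at hx
  | succ k ih =>
    rw [alternatingWord_succ, rightInvSeq_concat, List.concat_eq_append, List.mem_append,
      List.mem_map, List.mem_singleton] at hx
    rcases hx with ⟨y, hy, rfl⟩ | rfl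
    · obtain ⟨q, hq, rfl⟩ := ih hy
      refine ⟨q + 1, by omega, ?_⟩
      have h := mul_pow_mul (cs.simple i) (cs.simple j) q
      rw [MulAut.conj_apply, inv_simple, ← h, pow_succ]
      simp only [mul_assoc]
    · exact ⟨0, by omega, by simp⟩

/-- If `i` is a right descent of an element with a reduced factorization ending in an alternating
word `⋯ i j` shorter than the order of `i j`, there is one ending in the next longer word `⋯ j i`. -/
theorem exists_mul_alternatingWord_succ {i j : B} {k : ℕ} {w y : W}
    (hk : ∀ q, 0 < q → q ≤ k → (cs.simple i * cs.simple j) ^ q ≠ 1)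
    (hw : w = y * cs.wordProd (alternatingWord i j k)) (hl : cs.length w = cs.length y + k)
    (hi : cs.IsRightDescent w i) :
    ∃ y', w = y' * cs.wordProd (alternatingWord j i (k + 1)) ∧
      cs.length w = cs.length y' + (k + 1) := by
  obtain ⟨ω, hω, rfl⟩ := cs.exists_isReduced y
  have hwω : w = cs.wordProd (ω ++ alternatingWord i j k) := by rw [hw, wordProd_append]
  have hmem := cs.simple_mem_rightInvSeq (hwω ▸ hi)
  rw [rightInvSeq_append, List.mem_append, List.mem_map] at hmem
  set u := cs.wordProd (alternatingWord i j k) with hu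
  rcases hmem with ⟨x, hx, hxi⟩ | hmem
  · have hlt := (cs.isRightInversion_of_mem_rightInvSeq hω hx).2
    have hprod : w = cs.wordProd ω * x * cs.wordProd (alternatingWord j i (k + 1)) := by
      have hxx : x * x = 1 := (cs.isReflection_of_mem_rightInvSeq ω hx).mul_self
      rw [alternatingWord_succ, wordProd_concat, ← hu, ← hxi, hw]
      calc cs.wordProd ω * u = cs.wordProd ω * (x * x) * u := by rw [hxx, mul_one]
        _ = _ := by group
    refine ⟨_, hprod, ?_⟩
    have h1 := cs.length_mul_le (cs.wordProd ω * x) (cs.wordProd (alternatingWord j i (k + 1)))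
    have h2 := cs.length_wordProd_le (alternatingWord j i (k + 1))
    rw [length_alternatingWord] at h2
    rw [← hprod] at h1
    omega
  · obtain ⟨q, hq, h⟩ := cs.exists_of_mem_rightInvSeq_alternatingWord hmem
    refine absurd ?_ (hk (q + 1) (by omega) (by omega))
    have h' : (cs.simple i * cs.simple j) ^ q = cs.simple j * cs.simple i := by
      conv_rhs => rw [h]
      simp
    rw [pow_succ, h']
    simp [mul_assoc]

/-- An element with right descents `i` and `j` has a reduced factorization ending in any alternating
word in `i` and `j` of length at most the order of `i j`. -/
theorem exists_mul_alternatingWord {i j : B} {k : ℕ} {w : W}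
    (hk : orderOf (cs.simple i * cs.simple j) = 0 ∨ k ≤ orderOf (cs.simple i * cs.simple j))
    (hi : cs.IsRightDescent w i) (hj : cs.IsRightDescent w j) :
    ∃ y, w = y * cs.wordProd (alternatingWord i j k) ∧ cs.length w = cs.length y + k := by
  induction k generalizing i j with
  | zero => exact ⟨w, by simp [alternatingWord]⟩
  | succ k ih =>
    have hord : orderOf (cs.simple j * cs.simple i) = orderOf (cs.simple i * cs.simple j) := by
      rw [← orderOf_inv]; simp
    obtain ⟨y, hy, hl⟩ := ih (i := j) (j := i) (by rw [hord]; omega) hj hi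
    refine cs.exists_mul_alternatingWord_succ (fun q hq hqk h ↦ ?_) hy hl hj
    have hle := orderOf_le_of_pow_eq_one hq h
    have hpos := orderOf_pos_iff.2 (isOfFinOrder_iff_pow_eq_one.2 ⟨q, hq, h⟩)
    omega

end CoxeterSystem

/-- Lemma 3.1: there is no `w ∈ W` with `w = (w₁)(st) = (w₂)(sr)`. -/
theorem no_element_st_and_sr
{W : Type*} [Group W] {M : CoxeterMatrix (Fin 3)} (cs : CoxeterSystem M W)
    (r s t : W) (hr : r = cs.simple 0) (hs : s = cs.simple 1) (ht : t = cs.simple 2)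
    (hrt : orderOf (r * t) = 2)
    (hst : orderOf (s * t) = 3)
    (hsr : orderOf (s * r) = 0 ∨ 7 ≤ orderOf (s * r)) :
    ¬ ∃ w w1 w2 : W,
        w = w1 * s * t ∧ cs.length w = cs.length w1 + 2 ∧
        w = w2 * s * r ∧ cs.length w = cs.length w2 + 2 := by
  rintro ⟨w, w1, w2, h1, hl1, h2, hl2⟩
  induction hn : cs.length w using Nat.strong_induction_on generalizing w w1 w2 with
  | _ n ih =>
  have rr : r * r = 1 := by simp [hr]
  have ss : s * s = 1 := by simp [hs]
  have tt : t * t = 1 := by simp [ht]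
  have cr (x : W) : x * r * r = x := by rw [mul_assoc, rr, mul_one]
  have cs' (x : W) : x * s * s = x := by rw [mul_assoc, ss, mul_one]
  have ct (x : W) : x * t * t = x := by rw [mul_assoc, tt, mul_one]
  have lr (x : W) := cs.length_mul_simple x 0
  have ls (x : W) := cs.length_mul_simple x 1
  have lt (x : W) := cs.length_mul_simple x 2
  rw [← hr] at lr
  rw [← hs] at ls
  rw [← ht] at lt
  have comm (x : W) : x * r * t = x * t * r := by
    have h : (r * t) * (r * t) = 1 := by rw [← pow_two, ← hrt, pow_orderOf_eq_one]
    have h' : r * t = t * r := by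
      rw [mul_eq_one_iff_eq_inv.1 h, hr, ht]; simp
    rw [mul_assoc, h', ← mul_assoc]
  have braid (x : W) : x * s * t * s = x * t * s * t := by
    have h : (s * t * s) * (t * s * t) = 1 := by
      rw [← pow_orderOf_eq_one (s * t), hst]; simp only [pow_succ, pow_zero, one_mul, mul_assoc]
    have h' : s * t * s = t * s * t := by
      rw [mul_eq_one_iff_eq_inv.1 h, hs, ht]; simp [mul_assoc]
    calc x * s * t * s = x * (s * t * s) := by group
      _ = _ := by rw [h']; group
  have dRT (v : W) (hvr : cs.length (v * r) < cs.length v) (hvt : cs.length (v * t) < cs.length v) :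
      ∃ y, v = y * r * t ∧ cs.length v = cs.length y + 2 := by
    obtain ⟨y, hy, hl⟩ := cs.exists_mul_alternatingWord (i := 0) (j := 2) (k := 2) (w := v)
      (by rw [← hr, ← ht]; omega) (by rw [hr] at hvr; exact hvr) (by rw [ht] at hvt; exact hvt)
    refine ⟨y, ?_, hl⟩
    rw [hy]
    simp [CoxeterSystem.alternatingWord, CoxeterSystem.wordProd, hr, ht, mul_assoc]
  have dST (v : W) (hvs : cs.length (v * s) < cs.length v) (hvt : cs.length (v * t) < cs.length v) :
      ∃ y, v = y * s * t * s ∧ cs.length v = cs.length y + 3 := by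
    obtain ⟨y, hy, hl⟩ := cs.exists_mul_alternatingWord (i := 1) (j := 2) (k := 3) (w := v)
      (by rw [← hs, ← ht]; omega) (by rw [hs] at hvs; exact hvs) (by rw [ht] at hvt; exact hvt)
    refine ⟨y, ?_, hl⟩
    rw [braid, hy]
    simp [CoxeterSystem.alternatingWord, CoxeterSystem.wordProd, hs, ht, mul_assoc]
  have dSR (v : W) (hvs : cs.length (v * s) < cs.length v) (hvr : cs.length (v * r) < cs.length v) :
      ∃ y, v = y * s * r * s * r * s * r ∧ cs.length v = cs.length y + 6 := by
    obtain ⟨y, hy, hl⟩ := cs.exists_mul_alternatingWord (i := 1) (j := 0) (k := 6) (w := v)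
      (by rw [← hs, ← hr]; omega) (by rw [hs] at hvs; exact hvs) (by rw [hr] at hvr; exact hvr)
    refine ⟨y, ?_, hl⟩
    rw [hy]
    simp [CoxeterSystem.alternatingWord, CoxeterSystem.wordProd, hs, hr, mul_assoc]
  have hwt : w * t = w1 * s := by rw [h1, ct]
  have hwr : w * r = w2 * s := by rw [h2, cr]
  have a1 := ls w1
  have a2 := lt w
  have a3 := ls w2
  have a4 := lr w
  rw [hwt] at a2
  rw [hwr] at a4
  obtain ⟨x, hx, hlx⟩ := dRT w (by rw [hwr]; omega) (by rw [hwt]; omega)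
  have hxr : x * r = w1 * s := by rw [← hwt, hx, ct]
  have hxt : x * t = w2 * s := by rw [← hwr, hx, comm, cr]
  obtain ⟨y, hy, hly⟩ := dSR (x * r) (by rw [hxr, cs']; omega) (by rw [cr, hxr]; omega)
  obtain ⟨z, hz, hlz⟩ := dST (x * t) (by rw [hxt, cs']; omega) (by rw [ct, hxt]; omega)
  have hxy : x = y * s * r * s * r * s := mul_right_cancel hy
  have hxz : x * s = z * t := by
    rw [braid] at hz
    rw [mul_right_cancel hz, cs']
  have hv : x * s = y * s * r * s * r := by rw [hxy, cs']
  have hvr : x * s * r = y * s * r * s := by rw [hv, cr]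
  have hvt : x * s * t = z := by rw [hxz, ct]
  rw [hxr] at hly
  rw [hxt] at hlz
  have b1 := ls x
  have b2 := lt z
  rw [← hxz] at b2
  have b3 := ls y
  have b4 := lr (y * s)
  have b5 := ls (y * s * r)
  have b6 := lr (y * s * r * s)
  rw [← hv] at b6
  obtain ⟨z', hz', hlz'⟩ := dRT (x * s) (by rw [hvr]; omega) (by rw [hvt]; omega)
  have hu : y * s * r * s = z' * t := by rw [← hvr, hz', comm, cr]
  obtain ⟨p, hp, hlp⟩ := dST (y * s * r * s) (by rw [cs']; omega) (by rw [hu, ct, ← hu]; omega)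
  exact ih _ (by omega) (y * s * r) p y (mul_right_cancel hp) (by omega) rfl (by omega) rfl
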